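/- arXiv:2205.11984 — 5 statements merged into one kernel-verified Lean document; each statement's English description precedes it below -/
import Mathlib

section
/- Let d be a positive integer, let A be a d×d complex matrix whose characteristic polynomial p = charpoly(A) factors as p = ∏_{i=1}^{d} (X − λ_i) with the λ_i pairwise distinct, and for each i define the matrix P_i = (1 / p'(λ_i)) · ∑_{m=0}^{d−1} ( ∑_{k=0}^{d−m−1} λ_i^k · c_{k+m+1} ) · A^m, where c_j is the coefficient of X^j in p. Then ∑_{i=1}^{d} P_i = 1 (the identity matrix). -/
open Polynomial Matrix

/-- With `P i = (1 / p'(λ i)) • ∑ m < d, (∑ k ≤ d-m-1, λ i ^ k * c (k+m+1)) • A ^ m` built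
from the characteristic polynomial `p` of `A` with pairwise distinct roots `λ i`, the spectral
projectors sum to the identity: `∑ i, P i = 1`. -/
theorem sum_spectral_projectors_eq_one
    (d : ℕ) (hd : 0 < d) (A : Matrix (Fin d) (Fin d) ℂ) (lam : Fin d → ℂ)
    (hfactor : A.charpoly = ∏ i : Fin d, (X - C (lam i)))
    (hdist : Function.Injective lam)
    (P : Fin d → Matrix (Fin d) (Fin d) ℂ)
    (hP : ∀ i, P i = (1 / (derivative A.charpoly).eval (lam i)) •
      ∑ m ∈ Finset.range d,
        (∑ k ∈ Finset.range (d - m), lam i ^ k * A.charpoly.coeff (k + m + 1)) • A ^ m) :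
    ∑ i : Fin d, P i = (1 : Matrix (Fin d) (Fin d) ℂ) := by
  have hn : A.charpoly = Lagrange.nodal Finset.univ lam := by
    rw [hfactor, Lagrange.nodal_eq]
  have hdeg : A.charpoly.natDegree = d := by
    rw [A.charpoly_natDegree_eq_dim, Fintype.card_fin]
  have key : ∀ i, P i = aeval A (Lagrange.basis Finset.univ lam i) := by
    intro i
    rw [Lagrange.basis_eq_prod_sub_inv_mul_nodal_div (Finset.mem_univ i),
      Lagrange.nodalWeight_eq_eval_derivative_nodal (Finset.mem_univ i), ← hn,
      ← divByMonic_eq_div _ (monic_X_sub_C _), hP i, map_mul, aeval_C,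
      ← Algebra.smul_def, one_div]
    congr 1
    have hlt : (A.charpoly /ₘ (X - C (lam i))).natDegree < d := by
      rw [natDegree_divByMonic _ (monic_X_sub_C _), hdeg, natDegree_X_sub_C]
      omega
    rw [aeval_eq_sum_range' hlt]
    refine Finset.sum_congr rfl fun m hm => ?_
    rw [coeff_divByMonic_X_sub_C, hdeg]
    congr 1
    rw [← Finset.Ico_add_one_right_eq_Icc, Finset.sum_Ico_eq_sum_range]
    have h1 : d + 1 - (m + 1) = d - m := by omega
    rw [h1]
    refine Finset.sum_congr rfl fun k _ => ?_
    rw [Nat.add_sub_cancel_left, show m + 1 + k = k + m + 1 by ring]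
  haveI : Nonempty (Fin d) := ⟨⟨0, hd⟩⟩
  simp_rw [key]
  rw [← map_sum, Lagrange.sum_basis hdist.injOn Finset.univ_nonempty, map_one]
end

section
/- Let d be a positive integer, let A be a d×d complex matrix whose characteristic polynomial p = charpoly(A) factors as p = ∏_{i=1}^{d} (X − λ_i) with the λ_i pairwise distinct, and for each i define the matrix P_i = (1 / p'(λ_i)) · ∑_{m=0}^{d−1} ( ∑_{k=0}^{d−m−1} λ_i^k · c_{k+m+1} ) · A^m, where c_j is the coefficient of X^j in p. Then ∑_{i=1}^{d} λ_i · P_i = A. -/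
open Polynomial Matrix

/-- With `P i = (1 / p'(λ i)) • ∑ m < d, (∑ k ≤ d-m-1, λ i ^ k * c (k+m+1)) • A ^ m` built
from the characteristic polynomial `p` of `A` with pairwise distinct roots `λ i`, the spectral
decomposition recovers the matrix: `∑ i, λ i • P i = A`. -/
theorem sum_root_smul_spectral_projectors_eq_self
    (d : ℕ) (hd : 0 < d) (A : Matrix (Fin d) (Fin d) ℂ) (lam : Fin d → ℂ)
    (hfactor : A.charpoly = ∏ i : Fin d, (X - C (lam i)))
    (hdist : Function.Injective lam)
    (P : Fin d → Matrix (Fin d) (Fin d) ℂ)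
    (hP : ∀ i, P i = (1 / (derivative A.charpoly).eval (lam i)) •
      ∑ m ∈ Finset.range d,
        (∑ k ∈ Finset.range (d - m), lam i ^ k * A.charpoly.coeff (k + m + 1)) • A ^ m) :
    ∑ i : Fin d, lam i • P i = A := by
  have hnod : A.charpoly = Lagrange.nodal Finset.univ lam := by
    rw [hfactor, Lagrange.nodal_eq]
  have hdeg : A.charpoly.natDegree = d := by
    rw [hnod, Lagrange.natDegree_nodal]; simp
  have hQ : ∀ i, ∑ m ∈ Finset.range d,
        (∑ k ∈ Finset.range (d - m), lam i ^ k * A.charpoly.coeff (k + m + 1)) • A ^ m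
        = aeval A (A.charpoly /ₘ (X - C (lam i))) := by
    intro i
    have hlt : (A.charpoly /ₘ (X - C (lam i))).natDegree < d := by
      rw [natDegree_divByMonic _ (monic_X_sub_C _), hdeg, natDegree_X_sub_C]; omega
    rw [aeval_eq_sum_range' hlt]
    refine Finset.sum_congr rfl fun m hm => ?_
    have hm' := Finset.mem_range.1 hm
    congr 1
    rw [coeff_divByMonic_X_sub_C, hdeg, ← Finset.Ico_add_one_right_eq_Icc,
      Finset.sum_Ico_eq_sum_range]
    have e : d + 1 - (m + 1) = d - m := by omega
    rw [e]
    refine Finset.sum_congr rfl fun k _ => ?_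
    have e1 : m + 1 + k - (m + 1) = k := by omega
    have e2 : m + 1 + k = k + m + 1 := by omega
    rw [e1, e2]
  have hmul : ∀ i, A * P i = lam i • P i := by
    intro i
    have h1 : (X - C (lam i)) * (A.charpoly /ₘ (X - C (lam i))) = A.charpoly := by
      rw [mul_divByMonic_eq_iff_isRoot, hnod]
      exact Lagrange.eval_nodal_at_node (Finset.mem_univ i)
    have h2 := congrArg (aeval A) h1
    rw [Matrix.aeval_self_charpoly, map_mul, map_sub, aeval_X, aeval_C, sub_mul, sub_eq_zero,
      ← Algebra.smul_def] at h2
    rw [hP i, hQ i, mul_smul_comm, h2, smul_comm]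
  have hsum : ∑ i, P i = 1 := by
    have : Nonempty (Fin d) := ⟨⟨0, hd⟩⟩
    have h1 := congrArg (aeval A) (Lagrange.sum_basis (s := Finset.univ) (v := lam)
      hdist.injOn Finset.univ_nonempty)
    rw [map_sum, map_one] at h1
    rw [← h1]
    refine Finset.sum_congr rfl fun i hi => ?_
    rw [Lagrange.basis_eq_prod_sub_inv_mul_nodal_div hi,
      Lagrange.nodalWeight_eq_eval_derivative_nodal hi, hP i, hQ i, hnod, map_mul, aeval_C,
      ← Algebra.smul_def, one_div, ← divByMonic_eq_div _ (monic_X_sub_C _)]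
  calc ∑ i, lam i • P i = ∑ i, A * P i := Finset.sum_congr rfl fun i _ => (hmul i).symm
    _ = A := by rw [← Finset.mul_sum, hsum, mul_one]
end

section
/- Let d be a positive integer, let A be a d×d complex matrix whose characteristic polynomial p = charpoly(A) factors as p = ∏_{i=1}^{d} (X − λ_i) with the λ_i pairwise distinct, and for each i define the matrix P_i = (1 / p'(λ_i)) · ∑_{m=0}^{d−1} ( ∑_{k=0}^{d−m−1} λ_i^k · c_{k+m+1} ) · A^m, where c_j is the coefficient of X^j in p. Then for every polynomial f with complex coefficients, the evaluation of f at the matrix A satisfies f(A) = ∑_{i=1}^{d} f(λ_i) · P_i. -/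
open Polynomial Matrix

/-- With `P i = (1 / p'(λ i)) • ∑ m < d, (∑ k ≤ d-m-1, λ i ^ k * c (k+m+1)) • A ^ m` built
from the characteristic polynomial `p` of `A` with pairwise distinct roots `λ i`, every
polynomial function of `A` has the spectral decomposition `f(A) = ∑ i, f(λ i) • P i`. -/
theorem aeval_eq_sum_eval_smul_spectral_projectors
    (d : ℕ) (hd : 0 < d) (A : Matrix (Fin d) (Fin d) ℂ) (lam : Fin d → ℂ)
    (hfactor : A.charpoly = ∏ i : Fin d, (X - C (lam i)))
    (hdist : Function.Injective lam)
    (P : Fin d → Matrix (Fin d) (Fin d) ℂ)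
    (hP : ∀ i, P i = (1 / (derivative A.charpoly).eval (lam i)) •
      ∑ m ∈ Finset.range d,
        (∑ k ∈ Finset.range (d - m), lam i ^ k * A.charpoly.coeff (k + m + 1)) • A ^ m) :
    ∀ f : Polynomial ℂ, Polynomial.aeval A f = ∑ i : Fin d, f.eval (lam i) • P i := by
  intro f
  have hnod : A.charpoly = Lagrange.nodal Finset.univ lam := hfactor
  have hdeg : A.charpoly.natDegree = d := by
    rw [hnod, Lagrange.natDegree_nodal]; simp
  have hinj : Set.InjOn lam ((Finset.univ : Finset (Fin d)) : Set (Fin d)) := hdist.injOn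
  have hmon : A.charpoly.Monic := A.charpoly_monic
  have hr : f %ₘ A.charpoly
      = Lagrange.interpolate Finset.univ lam (fun i => f.eval (lam i)) := by
    apply Lagrange.eq_interpolate_of_eval_eq _ hinj
    · have h := Polynomial.degree_modByMonic_lt f hmon
      have h2 : A.charpoly.degree = (Finset.univ : Finset (Fin d)).card := by
        rw [hnod, Lagrange.degree_nodal]
      rwa [h2] at h
    · intro i hi
      have h0 : A.charpoly.eval (lam i) = 0 := by
        rw [hnod]
        exact Lagrange.eval_nodal_at_node hi
      have h := congrArg (Polynomial.eval (lam i)) (Polynomial.modByMonic_add_div f A.charpoly)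
      simpa [h0] using h
  rw [Matrix.aeval_eq_aeval_mod_charpoly, hr,
    Lagrange.interpolate_eq_nodalWeight_mul_nodal_div_X_sub_C, map_sum]
  refine Finset.sum_congr rfl fun i hi => ?_
  have hq : A.charpoly /ₘ (X - C (lam i)) = ∑ m ∈ Finset.range d,
      C (∑ k ∈ Finset.range (d - m), lam i ^ k * A.charpoly.coeff (k + m + 1)) * X ^ m := by
    ext n
    rw [Polynomial.coeff_divByMonic_X_sub_C, Polynomial.finsetSum_coeff, hdeg]
    simp only [Polynomial.coeff_C_mul_X_pow]
    rw [Finset.sum_ite_eq]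
    have hI : Finset.Icc (n + 1) d = Finset.Ico (n + 1) (d + 1) := by ext; simp
    rw [hI, Finset.sum_Ico_eq_sum_range]
    have e : d + 1 - (n + 1) = d - n := by omega
    rw [e]
    split_ifs with h
    · refine Finset.sum_congr rfl fun k _ => ?_
      have e1 : n + 1 + k - (n + 1) = k := by omega
      have e2 : n + 1 + k = k + n + 1 := by omega
      rw [e1, e2]
    · have : d - n = 0 := by simp at h; omega
      rw [this]; simp
  rw [Lagrange.nodalWeight_eq_eval_derivative_nodal hi, ← hnod,
    ← Polynomial.divByMonic_eq_div _ (Polynomial.monic_X_sub_C _), hq, hP i]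
  generalize hc : (fun m => ∑ k ∈ Finset.range (d - m),
    lam i ^ k * A.charpoly.coeff (k + m + 1)) = c
  have hc' : ∀ m, ∑ k ∈ Finset.range (d - m),
    lam i ^ k * A.charpoly.coeff (k + m + 1) = c m := fun m => congrFun hc m
  simp only [hc']
  have hs : aeval A (∑ m ∈ Finset.range d, C (c m) * X ^ m)
      = ∑ m ∈ Finset.range d, c m • A ^ m := by
    simp [map_sum, Algebra.algebraMap_eq_smul_one]
  rw [map_mul, map_mul, hs, aeval_C, aeval_C, ← Algebra.commutes, ← Algebra.smul_def,
    ← Algebra.smul_def, one_div]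
end

section
/- Let d be a positive integer and let A be a d×d matrix over a field K of characteristic zero. Define sequences (c_k) of scalars and (B_k) of matrices recursively by B_0 = 1 (the identity matrix), and for k = 1, …, d: c_k = −trace(A·B_{k−1})/k and B_k = A·B_{k−1} + c_k·1. Then for every k with 1 ≤ k ≤ d, c_k equals the coefficient of X^{d−k} in the characteristic polynomial of A, i.e. c_k = charpoly(A).coeff(d−k); moreover B_d = 0. -/
open Polynomial Matrix

lemma derivative_charpoly_aux (d : ℕ) (K : Type*) [Field K] (A : Matrix (Fin d) (Fin d) K) :
    derivative A.charpoly = trace (adjugate (charmatrix A)) := by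
  have key : ∀ i, adjugate (charmatrix A) i i = ∑ σ : Equiv.Perm (Fin d),
      (Equiv.Perm.sign σ : ℤ) • ((∏ j ∈ Finset.univ.erase i, charmatrix A (σ j) j) *
        derivative (charmatrix A (σ i) i)) := by
    intro i
    rw [← transpose_apply (adjugate _), adjugate_transpose, adjugate_apply,
      ← det_transpose, updateRow_transpose, transpose_transpose, det_apply]
    refine Finset.sum_congr rfl fun σ _ => ?_
    rw [Units.smul_def]
    congr 1
    rw [← Finset.mul_prod_erase _ _ (Finset.mem_univ i), mul_comm]
    congr 1
    · refine Finset.prod_congr rfl fun j hj => ?_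
      rw [updateCol_ne (Finset.ne_of_mem_erase hj)]
    · rw [updateCol_self]
      by_cases h : σ i = i
      · rw [h, charmatrix_apply_eq]; simp
      · rw [charmatrix_apply_ne _ _ _ h]; simp [h]
  rw [Matrix.charpoly, det_apply, trace, derivative_sum]
  simp only [diag_apply, key]
  rw [Finset.sum_comm]
  refine Finset.sum_congr rfl fun σ _ => ?_
  rw [Units.smul_def, derivative_smul, derivative_prod_finset, Finset.smul_sum]

theorem faddeev_leverrier
    (d : ℕ) (hd : 0 < d) (K : Type*) [Field K] [CharZero K]
    (A : Matrix (Fin d) (Fin d) K)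
    (c : ℕ → K) (B : ℕ → Matrix (Fin d) (Fin d) K)
    (hB0 : B 0 = 1)
    (hc : ∀ k, 1 ≤ k → k ≤ d → c k = -(Matrix.trace (A * B (k - 1))) / (k : K))
    (hB : ∀ k, 1 ≤ k → k ≤ d → B k = A * B (k - 1) + c k • (1 : Matrix (Fin d) (Fin d) K)) :
    (∀ k, 1 ≤ k → k ≤ d → c k = A.charpoly.coeff (d - k)) ∧ B d = 0 := by
  obtain ⟨N, hN⟩ : ∃ N, N = matPolyEquiv (adjugate (charmatrix A)) := ⟨_, rfl⟩
  have hmul : (X - C A) * N = A.charpoly.map (algebraMap K (Matrix (Fin d) (Fin d) K)) := by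
    rw [hN, ← matPolyEquiv_charmatrix, ← map_mul, mul_adjugate, ← matPolyEquiv_smul_one]
    rfl
  have h0 : A * N.coeff 0 + A.charpoly.coeff 0 • (1 : Matrix (Fin d) (Fin d) K) = 0 := by
    have := congrArg (fun q => q.coeff 0) hmul
    simp only [sub_mul, coeff_sub, coeff_map, coeff_C_mul, coeff_X_mul_zero,
      Algebra.algebraMap_eq_smul_one] at this
    rw [← this]; simp
  have hs : ∀ k, N.coeff k = A * N.coeff (k+1) +
      A.charpoly.coeff (k+1) • (1 : Matrix (Fin d) (Fin d) K) := by
    intro k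
    have := congrArg (fun q => q.coeff (k+1)) hmul
    simp only [sub_mul, coeff_sub, coeff_map, coeff_C_mul, coeff_X_mul,
      Algebra.algebraMap_eq_smul_one] at this
    rw [← this]; simp
  have htr : ∀ k, A.charpoly.coeff (k+1) * ((k:K)+1) = trace (N.coeff k) := by
    intro k
    rw [← coeff_derivative, derivative_charpoly_aux, hN, trace, trace, finset_sum_coeff]
    simp [matPolyEquiv_coeff_apply]
  have hdeg : A.charpoly.natDegree = d := by simp
  have hz : ∀ k, d ≤ k → N.coeff k = 0 := by
    have : ∀ t k, d ≤ k → N.natDegree < k + t → N.coeff k = 0 := by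
      intro t
      induction t with
      | zero => intro k _ h; exact coeff_eq_zero_of_natDegree_lt h
      | succ t ih =>
        intro k hk h
        rw [hs, ih (k+1) (by omega) (by omega),
          coeff_eq_zero_of_natDegree_lt (p := A.charpoly) (by omega)]
        simp
    intro k hk
    exact this (N.natDegree + 1) k hk (by omega)
  have hlead : A.charpoly.coeff d = 1 := by
    have := A.charpoly_monic.coeff_natDegree
    rwa [hdeg] at this
  have hcoef : ∀ j, j < d → B j = N.coeff (d - 1 - j) →
      c (j+1) = A.charpoly.coeff (d - (j+1)) := by
    intro j hj hBj
    rw [hc (j+1) (by omega) hj, Nat.add_sub_cancel, hBj]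
    have hne : ((j+1 : ℕ) : K) ≠ 0 := by exact_mod_cast Nat.succ_ne_zero j
    rw [div_eq_iff hne]
    obtain ⟨m, rfl⟩ : ∃ m, d = m + (j + 1) := ⟨d - (j+1), by omega⟩
    have e1 : m + (j+1) - 1 - j = m := by omega
    have e2 : m + (j+1) - (j+1) = m := by omega
    rw [e1, e2]
    cases m with
    | zero =>
      have := congrArg trace h0
      simp only [trace_add, trace_smul, trace_one, Fintype.card_fin, trace_zero, smul_eq_mul] at this
      push_cast at this ⊢
      linear_combination -this
    | succ m =>
      have := congrArg trace (hs m)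
      rw [← htr] at this
      simp only [trace_add, trace_smul, trace_one, Fintype.card_fin, smul_eq_mul] at this
      push_cast at this ⊢
      linear_combination this
  have hBN : ∀ j, j < d → B j = N.coeff (d - 1 - j) := by
    intro j
    induction j with
    | zero =>
      intro _
      rw [hs, hz _ (by omega), hB0, show d - 1 - 0 + 1 = d by omega, hlead]; simp
    | succ j ih =>
      intro hj
      have hj' := ih (by omega)
      rw [hB (j+1) (by omega) (by omega), hcoef j (by omega) hj', Nat.add_sub_cancel, hj',
        hs (d - 1 - (j+1)), show d - 1 - (j+1) + 1 = d - 1 - j by omega,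
        show d - (j+1) = d - 1 - j by omega]
  refine ⟨fun k h1 h2 => ?_, ?_⟩
  · obtain ⟨j, rfl⟩ : ∃ j, k = j + 1 := ⟨k - 1, by omega⟩
    exact hcoef j h2 (hBN j h2)
  · obtain ⟨j, rfl⟩ : ∃ j, d = j + 1 := ⟨d - 1, by omega⟩
    have hj := hBN j (by omega)
    rw [hB (j+1) (by omega) le_rfl, hcoef j (by omega) hj, Nat.add_sub_cancel, hj]
    simpa using h0
end

section
/- Let V be a real vector space of finite dimension 2 and let Q be a quadratic form on V. Then for every element A of the Clifford algebra Cl(Q), the product A · (reverse ∘ involute)(A) is a scalar, i.e. it lies in the image of the structure map ℝ → Cl(Q). (Here (reverse ∘ involute)(A) is the Clifford conjugate Ā of A, which for an algebra generated in dimension 2 coincides with negating all grades except the scalar; the statement is the n ≤ 2 case of the determinant formula Det(A) = A·Ā.) -/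
open CliffordAlgebra

/-- For a quadratic form `Q` on a 2-dimensional real vector space, the product of any element
`A` of the Clifford algebra with its Clifford conjugate `reverse (involute A)` is a scalar,
i.e. lies in the range of the structure map `ℝ → CliffordAlgebra Q`. This is the `n ≤ 2` case
of the determinant formula `Det A = A * Ā`. -/
theorem mul_cliffordConjugate_mem_scalar_range_of_dim_two
    (V : Type*) [AddCommGroup V] [Module ℝ V] (hdim : Module.finrank ℝ V = 2)
    (Q : QuadraticForm ℝ V) (A : CliffordAlgebra Q) :
    A * reverse (involute A) ∈ (algebraMap ℝ (CliffordAlgebra Q)).range := by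
  have : FiniteDimensional ℝ V := Module.finite_of_finrank_pos (by omega)
  let B := Module.finBasisOfFinrankEq ℝ V hdim
  obtain ⟨x, hx⟩ : ∃ x, x = ι Q (B 0) := ⟨_, rfl⟩
  obtain ⟨y, hy⟩ : ∃ y, y = ι Q (B 1) := ⟨_, rfl⟩
  obtain ⟨t, ht⟩ : ∃ t, t = x * y := ⟨_, rfl⟩
  obtain ⟨a, hxx⟩ : ∃ a : ℝ, x * x = a • 1 :=
    ⟨Q (B 0), by rw [hx, ι_sq_scalar, Algebra.algebraMap_eq_smul_one]⟩
  obtain ⟨b, hyy⟩ : ∃ b : ℝ, y * y = b • 1 :=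
    ⟨Q (B 1), by rw [hy, ι_sq_scalar, Algebra.algebraMap_eq_smul_one]⟩
  obtain ⟨c, hyx⟩ : ∃ c : ℝ, y * x = c • 1 - t :=
    ⟨QuadraticMap.polar Q (B 1) (B 0), by
      rw [ht, hx, hy, ι_mul_ι_comm, Algebra.algebraMap_eq_smul_one]⟩
  have hxt : x * t = a • y := by rw [ht, ← mul_assoc, hxx, smul_mul_assoc, one_mul]
  have hty : t * y = b • x := by rw [ht, mul_assoc, hyy, mul_smul_comm, mul_one]
  have htx : t * x = c • x - a • y := by
    rw [ht, mul_assoc, hyx, mul_sub, hxt, mul_smul_comm, mul_one]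
  have hyt : y * t = c • y - b • x := by
    rw [ht, ← mul_assoc, hyx, sub_mul, hty, smul_mul_assoc, one_mul]
  have htt : t * t = c • t - (a * b) • 1 := by
    nth_rw 1 [ht]
    rw [mul_assoc, hyt, mul_sub, mul_smul_comm, mul_smul_comm, hxx, ← ht]
    module
  have key : ∃ p q r s : ℝ, A = p • 1 + q • x + r • y + s • t := by
    induction A using CliffordAlgebra.induction with
    | algebraMap k => exact ⟨k, 0, 0, 0, by rw [Algebra.algebraMap_eq_smul_one]; module⟩
    | ι v =>
      refine ⟨0, B.repr v 0, B.repr v 1, 0, ?_⟩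
      conv_lhs => rw [← B.sum_repr v]
      rw [Fin.sum_univ_two, map_add, map_smul, map_smul, ← hx, ← hy]
      module
    | mul u v hu hv =>
      obtain ⟨p, q, r, s, rfl⟩ := hu
      obtain ⟨p', q', r', s', rfl⟩ := hv
      refine ⟨p * p' + q * q' * a + r * r' * b + r * q' * c - s * s' * (a * b),
        p * q' + q * p' - r * s' * b + s * q' * c + s * r' * b,
        p * r' + r * p' + q * s' * a + r * s' * c - s * q' * a,
        p * s' + s * p' + q * r' - r * q' + s * s' * c, ?_⟩
      simp only [mul_add, add_mul, smul_mul_assoc, mul_smul_comm, one_mul, mul_one,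
        hxx, hyy, hyx, hxt, hty, htx, hyt, htt, ← ht]
      module
    | add u v hu hv =>
      obtain ⟨p, q, r, s, rfl⟩ := hu
      obtain ⟨p', q', r', s', rfl⟩ := hv
      exact ⟨p + p', q + q', r + r', s + s', by module⟩
  obtain ⟨p, q, r, s, rfl⟩ := key
  have cx : reverse (involute x) = -x := by rw [hx, involute_ι, map_neg, reverse_ι]
  have cy : reverse (involute y) = -y := by rw [hy, involute_ι, map_neg, reverse_ι]
  have ct : reverse (involute t) = c • 1 - t := by
    rw [ht, map_mul, reverse.map_mul, cx, cy, neg_mul_neg, hyx, ht]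
  refine ⟨p ^ 2 + p * s * c - q ^ 2 * a - r ^ 2 * b - q * r * c + s ^ 2 * (a * b), ?_⟩
  rw [Algebra.algebraMap_eq_smul_one]
  simp only [map_add, map_smul, map_one, reverse.map_one, cx, cy, ct]
  simp only [mul_add, add_mul, mul_sub, mul_neg, smul_mul_assoc, mul_smul_comm, one_mul, mul_one,
        hxx, hyy, hyx, hxt, hty, htx, hyt, htt, ← ht]
  module
end
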